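/- arXiv:2001.07949 — 10 statements merged into one kernel-verified Lean document; each statement's English description precedes it below -/
import Mathlib

section
/- Suppose θ̃ ∈ (ℝ^N)^T is a global minimizer of the group lasso objective Q*. Then for every block index i ∈ {1,…,T}, one has ‖Σ_{s=i}^T (y_s − ⟨X_s, θ̃_1 + ⋯ + θ̃_s⟩) X_s‖ ≤ Tλ/2. -/
open Finset RealInnerProductSpace

/-- If `a * ε ≤ b * ε + c * ε ^ 2` for all `ε > 0`, then comparing the terms linear in `ε`
gives `a ≤ b`. -/
lemma le_of_forall_pos_mul_le_mul_add_mul_sq {a b c : ℝ}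
    (h : ∀ ε : ℝ, 0 < ε → a * ε ≤ b * ε + c * ε ^ 2) : a ≤ b := by
  have hlim : Filter.Tendsto (fun ε : ℝ => b + c * ε) (nhdsWithin 0 (Set.Ioi 0)) (nhds b) := by
    have hcont : Continuous fun ε : ℝ => b + c * ε := by fun_prop
    simpa using (hcont.tendsto 0).mono_left nhdsWithin_le_nhds
  refine ge_of_tendsto hlim ?_
  filter_upwards [self_mem_nhdsWithin] with ε hε
  have hε' : 0 < ε := hε
  exact le_of_mul_le_mul_right (by linarith [h ε hε']) hε'

/-- KKT inequality for every block of a global minimizer of the group lasso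
objective with the cumulative design map. -/
theorem stmt2
    (T N : ℕ) (hT : 0 < T) (hN : 0 < N)
    (X : Fin T → EuclideanSpace ℝ (Fin N)) (y : Fin T → ℝ)
    (lam : ℝ) (hlam : 0 < lam)
    (θ : Fin T → EuclideanSpace ℝ (Fin N))
    (hmin : ∀ η : Fin T → EuclideanSpace ℝ (Fin N),
      (1 / (T : ℝ)) * ∑ t, (y t - ⟪X t, ∑ k ∈ Finset.Iic t, θ k⟫) ^ 2
          + lam * ∑ i, ‖θ i‖
        ≤ (1 / (T : ℝ)) * ∑ t, (y t - ⟪X t, ∑ k ∈ Finset.Iic t, η k⟫) ^ 2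
          + lam * ∑ i, ‖η i‖) :
    ∀ i : Fin T,
      ‖∑ s ∈ Finset.Ici i, (y s - ⟪X s, ∑ k ∈ Finset.Iic s, θ k⟫) • X s‖
        ≤ (T : ℝ) * lam / 2 := by
  intro i
  set r : Fin T → ℝ := fun s => y s - ⟪X s, ∑ k ∈ Finset.Iic s, θ k⟫ with hr
  set g : EuclideanSpace ℝ (Fin N) := ∑ s ∈ Finset.Ici i, r s • X s with hg
  change ‖g‖ ≤ _
  have hT' : (0 : ℝ) < T := by exact_mod_cast hT
  let c : Fin T → ℝ := fun t => if i ≤ t then ⟪X t, g⟫ else 0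
  have hrc : ∑ t, r t * c t = ‖g‖ ^ 2 := by
    rw [← real_inner_self_eq_norm_sq]
    conv_rhs => enter [2]; rw [hg]
    simp only [sum_inner, real_inner_smul_left, c, mul_ite, mul_zero]
    rw [← Finset.sum_filter]
    congr 1
    ext t
    simp
  have hkey : 2 * ‖g‖ ^ 2 ≤ T * lam * ‖g‖ := by
    refine le_of_forall_pos_mul_le_mul_add_mul_sq (c := ∑ t, c t ^ 2) fun ε hε => ?_
    let δ : Fin T → EuclideanSpace ℝ (Fin N) := Pi.single i (ε • g)
    have hη := hmin (fun k => θ k + δ k)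
    have hres : ∀ t, y t - ⟪X t, ∑ k ∈ Finset.Iic t, (θ k + δ k)⟫
        = r t - ε * c t := by
      intro t
      by_cases h : i ≤ t <;>
        simp [δ, r, c, h, Finset.sum_add_distrib, inner_add_right, real_inner_smul_right,
          sub_sub]
    have hloss : ∑ t, (r t - ε * c t) ^ 2
        = ∑ t, r t ^ 2 - 2 * ε * ‖g‖ ^ 2 + ε ^ 2 * ∑ t, c t ^ 2 := by
      rw [← hrc, Finset.mul_sum, Finset.mul_sum, ← Finset.sum_sub_distrib,
        ← Finset.sum_add_distrib]
      exact Finset.sum_congr rfl fun t _ => by ring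
    have hpen : ∑ j, ‖θ j + δ j‖ ≤ ∑ j, ‖θ j‖ + ε * ‖g‖ := by
      have hsingle : ∑ j, ‖δ j‖ = ε * ‖g‖ := by
        rw [Finset.sum_eq_single i (fun j _ hj => by simp [δ, hj]) (by simp)]
        simp [δ, norm_smul, abs_of_pos hε]
      rw [← hsingle, ← Finset.sum_add_distrib]
      exact Finset.sum_le_sum fun j _ => norm_add_le _ _
    simp only [hres, hloss] at hη
    change 1 / (T : ℝ) * ∑ t, r t ^ 2 + _ ≤ _ at hη
    have hpen' := mul_le_mul_of_nonneg_left hpen hlam.le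
    have hdiv : 1 / (T : ℝ) * (2 * ε * ‖g‖ ^ 2 - ε ^ 2 * ∑ t, c t ^ 2) ≤ lam * (ε * ‖g‖) := by
      linarith
    rw [one_div, inv_mul_le_iff₀ hT'] at hdiv
    linarith
  rcases (norm_nonneg g).eq_or_lt with h0 | hpos
  · rw [← h0]
    positivity
  · have : 2 * ‖g‖ ≤ T * lam := le_of_mul_le_mul_right (by linarith) hpos
    linarith
end

section
/- If θ̂ ∈ (ℝ^N)^M is a global minimizer of the adaptive group lasso objective Q, then: (i) for every block index i with θ̂_i ≠ 0, Z_i'(y − Zθ̂) = (Tλw_i/2) · θ̂_i/‖θ̂_i‖; and (ii) for every block index i with θ̂_i = 0, ‖Z_i'(y − Zθ̂)‖ ≤ Tλw_i/2. -/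
open Finset RealInnerProductSpace

section Subgradient

variable {E : Type*} [NormedAddCommGroup E] [InnerProductSpace ℝ E]

/-- A subgradient of `c‖·‖` at any point has norm at most `c`. -/
theorem norm_le_of_subgradient_norm {g x : E} {c : ℝ} (hc : 0 ≤ c)
    (h : ∀ u, ⟪g, u⟫ ≤ c * (‖x + u‖ - ‖x‖)) : ‖g‖ ≤ c := by
  have hg : ‖g‖ * ‖g‖ ≤ c * ‖g‖ := by
    rw [← real_inner_self_eq_norm_mul_norm]
    refine (h g).trans (mul_le_mul_of_nonneg_left ?_ hc)
    linarith [norm_add_le x g]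
  by_contra! hlt
  nlinarith

/-- The only subgradient of `c‖·‖` at `x ≠ 0` is `(c / ‖x‖) • x`. -/
theorem eq_smul_of_subgradient_norm {g x : E} {c : ℝ} (hc : 0 ≤ c) (hx : x ≠ 0)
    (h : ∀ u, ⟪g, u⟫ ≤ c * (‖x + u‖ - ‖x‖)) : g = (c / ‖x‖) • x := by
  have hg := norm_le_of_subgradient_norm hc h
  have hpos : 0 < ‖x‖ := norm_pos_iff.mpr hx
  have hinner : c * ‖x‖ ≤ ⟪g, x⟫ := by
    have := h (-x)
    simp only [inner_neg_right, add_neg_cancel, norm_zero] at this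
    linarith
  have hsq : ‖g - (c / ‖x‖) • x‖ ^ 2 = ‖g‖ ^ 2 - 2 * (c / ‖x‖ * ⟪g, x⟫) + c ^ 2 := by
    rw [norm_sub_sq_real, real_inner_smul_right, norm_smul, Real.norm_of_nonneg (by positivity),
      div_mul_cancel₀ _ hpos.ne']
  have hcc : c ^ 2 ≤ c / ‖x‖ * ⟪g, x⟫ := by
    calc c ^ 2 = c / ‖x‖ * (c * ‖x‖) := by field_simp
      _ ≤ _ := by gcongr
  have hg2 : ‖g‖ ^ 2 ≤ c ^ 2 := by gcongr
  rw [← sub_eq_zero, ← norm_eq_zero, ← sq_eq_zero_iff]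
  exact le_antisymm (by linarith) (sq_nonneg _)

end Subgradient

theorem nonpos_of_forall_le_mul {d q : ℝ} (hq : 0 ≤ q)
    (h : ∀ t : ℝ, 0 < t → t ≤ 1 → d ≤ t * q) : d ≤ 0 := by
  by_contra! hd
  have hle := h (d / (d + q)) (by positivity) ((div_le_one (by positivity)).mpr (by linarith))
  rw [div_mul_eq_mul_div, le_div_iff₀ (by positivity)] at hle
  nlinarith

/-- At a minimizer of a penalized least-squares objective in one block, the correlation of
the block with the residual is a subgradient of the penalty. -/
theorem inner_adjoint_le_of_forall_sq_norm_add_le {E F : Type*}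
    [NormedAddCommGroup E] [InnerProductSpace ℝ E] [FiniteDimensional ℝ E]
    [NormedAddCommGroup F] [InnerProductSpace ℝ F] [FiniteDimensional ℝ F]
    (A : E →ₗ[ℝ] F) {r : F} {x : E} {c : ℝ} (hc : 0 ≤ c)
    (h : ∀ v, ‖r‖ ^ 2 + 2 * c * ‖x‖ ≤ ‖r - A v‖ ^ 2 + 2 * c * ‖x + v‖) (u : E) :
    ⟪LinearMap.adjoint A r, u⟫ ≤ c * (‖x + u‖ - ‖x‖) := by
  rw [LinearMap.adjoint_inner_left]
  suffices 2 * ⟪r, A u⟫ - 2 * c * (‖x + u‖ - ‖x‖) ≤ 0 by linarith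
  refine nonpos_of_forall_le_mul (sq_nonneg ‖A u‖) fun t ht ht1 => ?_
  have hconv : ‖x + t • u‖ ≤ (1 - t) * ‖x‖ + t * ‖x + u‖ := by
    have hcomb : x + t • u = (1 - t) • x + t • (x + u) := by module
    rw [hcomb]
    refine (norm_add_le _ _).trans_eq ?_
    rw [norm_smul, norm_smul, Real.norm_of_nonneg (sub_nonneg.mpr ht1), Real.norm_of_nonneg ht.le]
  have hv := h (t • u)
  rw [map_smul, norm_sub_sq_real, real_inner_smul_right, norm_smul, mul_pow,
    Real.norm_of_nonneg ht.le] at hv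
  have hpen := mul_le_mul_of_nonneg_left hconv hc
  refine le_of_mul_le_mul_left ?_ ht
  linarith

/-- KKT conditions (necessity) for the adaptive group lasso: a global minimizer
satisfies the stationarity equation on active blocks and the subgradient
inequality on inactive blocks. -/
theorem stmt3
    (T M N : ℕ) (hT : 0 < T)
    (Z : Fin M → EuclideanSpace ℝ (Fin N) →ₗ[ℝ] EuclideanSpace ℝ (Fin T))
    (y : EuclideanSpace ℝ (Fin T)) (w : Fin M → ℝ) (hw : ∀ i, 0 ≤ w i)
    (lam : ℝ) (hlam : 0 < lam)
    (θ : Fin M → EuclideanSpace ℝ (Fin N))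
    (hmin : ∀ η : Fin M → EuclideanSpace ℝ (Fin N),
      (1 / (T : ℝ)) * ‖y - ∑ i, Z i (θ i)‖ ^ 2 + lam * ∑ i, w i * ‖θ i‖
        ≤ (1 / (T : ℝ)) * ‖y - ∑ i, Z i (η i)‖ ^ 2 + lam * ∑ i, w i * ‖η i‖) :
    (∀ i, θ i ≠ 0 →
        LinearMap.adjoint (Z i) (y - ∑ j, Z j (θ j))
          = (((T : ℝ) * lam * w i / 2) / ‖θ i‖) • θ i)
    ∧ ∀ i, θ i = 0 →
        ‖LinearMap.adjoint (Z i) (y - ∑ j, Z j (θ j))‖ ≤ (T : ℝ) * lam * w i / 2 := by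
  have hc : ∀ i, 0 ≤ (T : ℝ) * lam * w i / 2 := fun i => by
    have := hw i
    positivity
  have hsub : ∀ i u, ⟪LinearMap.adjoint (Z i) (y - ∑ j, Z j (θ j)), u⟫
      ≤ (T : ℝ) * lam * w i / 2 * (‖θ i + u‖ - ‖θ i‖) := fun i =>
    inner_adjoint_le_of_forall_sq_norm_add_le (Z i) (hc i) fun v => by
      have hT' : (0 : ℝ) < T := Nat.cast_pos.mpr hT
      have hfit : ∑ j, Z j (Function.update θ i (θ i + v) j) = ∑ j, Z j (θ j) + Z i v := by
        rw [← add_sum_erase _ _ (mem_univ i), ← add_sum_erase _ (fun j => Z j (θ j)) (mem_univ i),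
          Function.update_self, map_add,
          sum_congr rfl fun j hj => by rw [Function.update_of_ne (ne_of_mem_erase hj)]]
        abel
      have hpen : ∑ j, w j * ‖Function.update θ i (θ i + v) j‖
          = ∑ j, w j * ‖θ j‖ + w i * (‖θ i + v‖ - ‖θ i‖) := by
        rw [← add_sum_erase _ _ (mem_univ i), ← add_sum_erase _ (fun j => w j * ‖θ j‖) (mem_univ i),
          Function.update_self,
          sum_congr rfl fun j hj => by rw [Function.update_of_ne (ne_of_mem_erase hj)]]
        ring
      have hle := mul_le_mul_of_nonneg_left (hmin (Function.update θ i (θ i + v))) hT'.le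
      rw [hfit, hpen, ← sub_sub] at hle
      simp only [mul_add, one_div, mul_inv_cancel_left₀ hT'.ne'] at hle
      linarith
  exact ⟨fun i hi => eq_smul_of_subgradient_norm (hc i) hi (hsub i),
    fun i _ => norm_le_of_subgradient_norm (hc i) (hsub i)⟩
end

section
/- Suppose θ̂ ∈ (ℝ^N)^M satisfies: (i) for every block index i with θ̂_i ≠ 0, Z_i'(y − Zθ̂) = (Tλw_i/2) · θ̂_i/‖θ̂_i‖; and (ii) for every block index i with θ̂_i = 0, ‖Z_i'(y − Zθ̂)‖ ≤ Tλw_i/2. Then θ̂ is a global minimizer of the adaptive group lasso objective Q. -/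
open Finset RealInnerProductSpace

/-- Subgradient inequality for `c * ‖·‖`, from the description of its subdifferential. -/
theorem inner_sub_le_mul_norm_sub_norm {E : Type*} [NormedAddCommGroup E] [InnerProductSpace ℝ E]
    {c : ℝ} (hc : 0 ≤ c) {g a : E} (hne : a ≠ 0 → g = (c / ‖a‖) • a) (hzero : a = 0 → ‖g‖ ≤ c)
    (b : E) : inner ℝ g (b - a) ≤ c * (‖b‖ - ‖a‖) := by
  by_cases ha : a = 0
  · subst ha
    simpa using (real_inner_le_norm g b).trans
      (mul_le_mul_of_nonneg_right (hzero rfl) (norm_nonneg b))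
  · have hpos : 0 < ‖a‖ := norm_pos_iff.mpr ha
    rw [hne ha, real_inner_smul_left, inner_sub_right, real_inner_self_eq_norm_sq]
    calc c / ‖a‖ * (inner ℝ a b - ‖a‖ ^ 2)
        ≤ c / ‖a‖ * (‖a‖ * ‖b‖ - ‖a‖ ^ 2) := by
          gcongr
          exact real_inner_le_norm a b
      _ = c * (‖b‖ - ‖a‖) := by field_simp

/-- KKT conditions (sufficiency) for the adaptive group lasso: a point
satisfying the stationarity equation on its non-zero blocks and the subgradient
inequality on its zero blocks is a global minimizer. -/
theorem stmt4
    (T M N : ℕ) (hT : 0 < T)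
    (Z : Fin M → EuclideanSpace ℝ (Fin N) →ₗ[ℝ] EuclideanSpace ℝ (Fin T))
    (y : EuclideanSpace ℝ (Fin T)) (w : Fin M → ℝ) (hw : ∀ i, 0 ≤ w i)
    (lam : ℝ) (hlam : 0 < lam)
    (θ : Fin M → EuclideanSpace ℝ (Fin N))
    (hstat : ∀ i, θ i ≠ 0 →
        LinearMap.adjoint (Z i) (y - ∑ j, Z j (θ j))
          = (((T : ℝ) * lam * w i / 2) / ‖θ i‖) • θ i)
    (hsub : ∀ i, θ i = 0 →
        ‖LinearMap.adjoint (Z i) (y - ∑ j, Z j (θ j))‖ ≤ (T : ℝ) * lam * w i / 2) :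
    ∀ η : Fin M → EuclideanSpace ℝ (Fin N),
      (1 / (T : ℝ)) * ‖y - ∑ i, Z i (θ i)‖ ^ 2 + lam * ∑ i, w i * ‖θ i‖
        ≤ (1 / (T : ℝ)) * ‖y - ∑ i, Z i (η i)‖ ^ 2 + lam * ∑ i, w i * ‖η i‖ := by
  intro η
  have hT' : (0 : ℝ) < T := Nat.cast_pos.mpr hT
  set r := y - ∑ j, Z j (θ j) with hr
  have hres : y - ∑ i, Z i (η i) = r - ∑ i, Z i (η i - θ i) := by
    simp only [hr, map_sub, Finset.sum_sub_distrib]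
    abel
  have hinner : inner ℝ r (∑ i, Z i (η i - θ i))
      ≤ T * lam / 2 * (∑ i, w i * ‖η i‖ - ∑ i, w i * ‖θ i‖) := by
    rw [inner_sum, ← Finset.sum_sub_distrib, Finset.mul_sum]
    refine Finset.sum_le_sum fun i _ => ?_
    have hc : 0 ≤ (T : ℝ) * lam * w i / 2 := by
      have := hw i
      positivity
    rw [← LinearMap.adjoint_inner_left]
    refine (inner_sub_le_mul_norm_sub_norm hc (hstat i) (hsub i) (η i)).trans_eq ?_
    ring
  have hloss : ‖r‖ ^ 2 - T * lam * (∑ i, w i * ‖η i‖ - ∑ i, w i * ‖θ i‖)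
      ≤ ‖y - ∑ i, Z i (η i)‖ ^ 2 := by
    rw [hres, norm_sub_sq_real r]
    linarith [sq_nonneg ‖∑ i, Z i (η i - θ i)‖]
  have hscaled := mul_le_mul_of_nonneg_left hloss (one_div_pos.mpr hT').le
  have hcancel : (1 / (T : ℝ)) *
      (‖r‖ ^ 2 - T * lam * (∑ i, w i * ‖η i‖ - ∑ i, w i * ‖θ i‖))
      = (1 / (T : ℝ)) * ‖r‖ ^ 2 - lam * (∑ i, w i * ‖η i‖ - ∑ i, w i * ‖θ i‖) := by
    field_simp
  linarith
end

section
/- Assume y = Zθ⁰ + u for some θ⁰ ∈ (ℝ^N)^T and u ∈ ℝ^T, let Ā = {i : θ⁰_i ≠ 0} have exactly m₀ + 1 elements, and suppose ‖θ⁰_i‖ ≤ M_β for every i ∈ Ā. Let c₀ > 0 and δ ∈ ℝ, set λ = 2Nc₀T^δ, and suppose |(1/T) Σ_{i=j}^T X_{l,i} u_i| ≤ c₀T^δ for every j ∈ {1,…,T} and every coordinate l ∈ {1,…,N} (X_{l,i} denotes the l-th coordinate of X_i). If θ̃ is a global minimizer of the group lasso objective Q*, then (1/T)‖Z(θ⁰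 − θ̃)‖² ≤ 4Nc₀T^δ(m₀ + 1)M_β. -/
open Finset RealInnerProductSpace

/-- Summation by parts: pairing the noise with the cumulative design map. -/
theorem sum_mul_inner_sum_Iic {T N : ℕ} (X e : Fin T → EuclideanSpace ℝ (Fin N))
    (u : Fin T → ℝ) :
    ∑ t, u t * ⟪X t, ∑ k ∈ Finset.Iic t, e k⟫
      = ∑ k, ∑ l, e k l * ∑ t ∈ Finset.Ici k, X t l * u t := by
  have h1 : ∀ t, u t * ⟪X t, ∑ k ∈ Finset.Iic t, e k⟫
      = ∑ k ∈ Finset.Iic t, ∑ l, e k l * (X t l * u t) := by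
    intro t
    rw [inner_sum, Finset.mul_sum]
    refine Finset.sum_congr rfl fun k _ => ?_
    rw [PiLp.inner_apply, Finset.mul_sum]
    refine Finset.sum_congr rfl fun l _ => ?_
    simp only [RCLike.inner_apply, conj_trivial]
    ring
  simp_rw [h1]
  rw [Finset.sum_comm' (t' := Finset.univ) (s' := fun k => Finset.Ici k) (by simp)]
  refine Finset.sum_congr rfl fun k _ => ?_
  rw [Finset.sum_comm]
  simp_rw [Finset.mul_sum]

/-- Coordinatewise bounded noise correlations control the noise pairing by the group norm. -/
theorem abs_mean_mul_inner_sum_Iic_le {T N : ℕ} (X e : Fin T → EuclideanSpace ℝ (Fin N))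
    (u : Fin T → ℝ) (c : ℝ)
    (hc : ∀ (j : Fin T) (l : Fin N),
      |(1 / (T : ℝ)) * ∑ i ∈ Finset.Ici j, X i l * u i| ≤ c) :
    |(1 / (T : ℝ)) * ∑ t, u t * ⟪X t, ∑ k ∈ Finset.Iic t, e k⟫|
      ≤ (N : ℝ) * c * ∑ k, ‖e k‖ := by
  rw [sum_mul_inner_sum_Iic, Finset.mul_sum, Finset.mul_sum]
  refine (Finset.abs_sum_le_sum_abs _ _).trans (Finset.sum_le_sum fun k _ => ?_)
  rw [Finset.mul_sum]
  refine (Finset.abs_sum_le_sum_abs _ _).trans ?_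
  have hterm : ∀ l ∈ (Finset.univ : Finset (Fin N)),
      |(1 / (T : ℝ)) * (e k l * ∑ t ∈ Finset.Ici k, X t l * u t)| ≤ ‖e k‖ * c := by
    intro l _
    rw [mul_left_comm, abs_mul]
    exact mul_le_mul (PiLp.norm_apply_le (e k) l) (hc k l) (abs_nonneg _) (norm_nonneg _)
  refine (Finset.sum_le_sum hterm).trans (le_of_eq ?_)
  simp
  ring

/-- Deterministic prediction-error bound for the group lasso (proof of
Theorem 1, on the event controlled by Lemma 1). -/
theorem stmt6
    (T N : ℕ) (hT : 0 < T)
    (X : Fin T → EuclideanSpace ℝ (Fin N)) (u : Fin T → ℝ)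
    (θ0 : Fin T → EuclideanSpace ℝ (Fin N)) (y : Fin T → ℝ)
    (hy : ∀ t, y t = ⟪X t, ∑ k ∈ Finset.Iic t, θ0 k⟫ + u t)
    (Abar : Finset (Fin T)) (hAbar : ∀ i, i ∈ Abar ↔ θ0 i ≠ 0)
    (m0 : ℕ) (hcard : Abar.card = m0 + 1)
    (Mβ : ℝ) (hMβ : ∀ i ∈ Abar, ‖θ0 i‖ ≤ Mβ)
    (c0 δ : ℝ) (hc0 : 0 < c0)
    (lam : ℝ) (hlamdef : lam = 2 * (N : ℝ) * c0 * (T : ℝ) ^ δ)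
    (hnoise : ∀ (j : Fin T) (l : Fin N),
      |(1 / (T : ℝ)) * ∑ i ∈ Finset.Ici j, X i l * u i| ≤ c0 * (T : ℝ) ^ δ)
    (θ : Fin T → EuclideanSpace ℝ (Fin N))
    (hmin : ∀ η : Fin T → EuclideanSpace ℝ (Fin N),
      (1 / (T : ℝ)) * ∑ t, (y t - ⟪X t, ∑ k ∈ Finset.Iic t, θ k⟫) ^ 2
          + lam * ∑ i, ‖θ i‖
        ≤ (1 / (T : ℝ)) * ∑ t, (y t - ⟪X t, ∑ k ∈ Finset.Iic t, η k⟫) ^ 2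
          + lam * ∑ i, ‖η i‖) :
    (1 / (T : ℝ)) * ∑ t, (⟪X t, ∑ k ∈ Finset.Iic t, (θ0 k - θ k)⟫) ^ 2
      ≤ 4 * (N : ℝ) * c0 * (T : ℝ) ^ δ * ((m0 : ℝ) + 1) * Mβ := by
  have hlam : 0 ≤ lam := by rw [hlamdef]; positivity
  have hnoise_bound :=
    abs_mean_mul_inner_sum_Iic_le X (fun k => θ0 k - θ k) u _ hnoise
  set a : Fin T → ℝ := fun t => ⟪X t, ∑ k ∈ Finset.Iic t, (θ0 k - θ k)⟫ with ha
  have hres : ∀ t, y t - ⟪X t, ∑ k ∈ Finset.Iic t, θ k⟫ = a t + u t := by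
    intro t
    rw [hy t, ha]
    simp only [Finset.sum_sub_distrib, inner_sub_right]
    ring
  have hres0 : ∀ t, y t - ⟪X t, ∑ k ∈ Finset.Iic t, θ0 k⟫ = u t := by
    intro t
    rw [hy t]
    ring
  have hbasic := hmin θ0
  simp_rw [hres, hres0] at hbasic
  have hexpand : ∑ t, (a t + u t) ^ 2
      = ∑ t, a t ^ 2 + 2 * ∑ t, u t * a t + ∑ t, u t ^ 2 := by
    rw [Finset.mul_sum, ← Finset.sum_add_distrib, ← Finset.sum_add_distrib]
    exact Finset.sum_congr rfl fun t _ => by ring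
  rw [hexpand] at hbasic
  have htri : ∑ k, ‖θ0 k - θ k‖ ≤ ∑ k, ‖θ0 k‖ + ∑ k, ‖θ k‖ := by
    rw [← Finset.sum_add_distrib]
    exact Finset.sum_le_sum fun k _ => norm_sub_le _ _
  have hsupp : ∑ k, ‖θ0 k‖ ≤ ((m0 : ℝ) + 1) * Mβ := by
    have hsub : ∑ k ∈ Abar, ‖θ0 k‖ = ∑ k, ‖θ0 k‖ :=
      Finset.sum_subset (Finset.subset_univ _) fun k _ hk => by
        have h0 : θ0 k = 0 := by simpa [hAbar] using hk
        simp [h0]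
    rw [← hsub]
    refine (Finset.sum_le_card_nsmul _ _ _ hMβ).trans (le_of_eq ?_)
    rw [hcard, nsmul_eq_mul]
    push_cast
    ring
  have hnoise_lower := (abs_le.mp hnoise_bound).1
  have htri_lam := mul_le_mul_of_nonneg_left htri hlam
  have hsupp_lam := mul_le_mul_of_nonneg_left hsupp hlam
  have hnoise_lam : (N : ℝ) * (c0 * (T : ℝ) ^ δ) * ∑ k, ‖θ0 k - θ k‖
      = lam * (∑ k, ‖θ0 k - θ k‖) / 2 := by
    rw [hlamdef]
    ring
  have hgoal : 4 * (N : ℝ) * c0 * (T : ℝ) ^ δ * ((m0 : ℝ) + 1) * Mβ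
      = 2 * (lam * (((m0 : ℝ) + 1) * Mβ)) := by
    rw [hlamdef]
    ring
  rw [hgoal]
  rw [hnoise_lam] at hnoise_lower
  linarith
end

section
/- Assume y = Zθ⁰ + u for some θ⁰ ∈ (ℝ^N)^T and u ∈ ℝ^T, let Ā = {i : θ⁰_i ≠ 0}, and let θ̃ be a global minimizer of the group lasso objective Q*. Set κ₁ = Σ_{i∈Ā}‖θ̃_i − θ⁰_i‖ and κ₂ = Σ_{i∉Ā}‖θ̃_i‖. Suppose there exist a, b ≥ 0 with 2·|Σ_{j∈Ā} ⟨θ̃_j − θ⁰_j, (1/T)Σ_{i=j}^T u_i X_i⟩| ≤ a·κ₁, 2·|Σ_{j∉Ā} ⟨θ̃_j, (1/T)Σ_{i=j}^T u_i X_i⟩| ≤ b·κ₂, and a + 2b < λ. Then κ₂ ≤ 2κ₁. -/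
open Finset RealInnerProductSpace

/-- Summation by parts: the adjoint of the cumulative design map. -/
theorem sum_mul_inner_sum_Iic_s7 {ι E : Type*} [Fintype ι] [LinearOrder ι]
    [LocallyFiniteOrderTop ι] [LocallyFiniteOrderBot ι]
    [NormedAddCommGroup E] [InnerProductSpace ℝ E] (X : ι → E) (u : ι → ℝ) (δ : ι → E) :
    ∑ t, u t * inner ℝ (X t) (∑ k ∈ Finset.Iic t, δ k)
      = ∑ k, inner ℝ (δ k) (∑ t ∈ Finset.Ici k, u t • X t) := by
  simp only [inner_sum, real_inner_smul_right, Finset.mul_sum]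
  rw [Finset.sum_comm' (t' := Finset.univ) (s' := fun k => Finset.Ici k) (by simp)]
  simp only [real_inner_comm]

/-- The cone condition `κ₂ ≤ 2κ₁` from the case analysis in the proof of
Theorem 1. -/
theorem stmt7
    (T N : ℕ) (hT : 0 < T)
    (X : Fin T → EuclideanSpace ℝ (Fin N)) (u : Fin T → ℝ)
    (θ0 : Fin T → EuclideanSpace ℝ (Fin N)) (y : Fin T → ℝ)
    (hy : ∀ t, y t = ⟪X t, ∑ k ∈ Finset.Iic t, θ0 k⟫ + u t)
    (Abar : Finset (Fin T)) (hAbar : ∀ i, i ∈ Abar ↔ θ0 i ≠ 0)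
    (lam : ℝ) (hlam : 0 < lam)
    (θ : Fin T → EuclideanSpace ℝ (Fin N))
    (hmin : ∀ η : Fin T → EuclideanSpace ℝ (Fin N),
      (1 / (T : ℝ)) * ∑ t, (y t - ⟪X t, ∑ k ∈ Finset.Iic t, θ k⟫) ^ 2
          + lam * ∑ i, ‖θ i‖
        ≤ (1 / (T : ℝ)) * ∑ t, (y t - ⟪X t, ∑ k ∈ Finset.Iic t, η k⟫) ^ 2
          + lam * ∑ i, ‖η i‖)
    (a b : ℝ) (ha : 0 ≤ a) (hb : 0 ≤ b)
    (hbound1 : 2 * |∑ j ∈ Abar, ⟪θ j - θ0 j, (1 / (T : ℝ)) • ∑ i ∈ Finset.Ici j, u i • X i⟫|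
      ≤ a * ∑ i ∈ Abar, ‖θ i - θ0 i‖)
    (hbound2 : 2 * |∑ j ∈ Abarᶜ, ⟪θ j, (1 / (T : ℝ)) • ∑ i ∈ Finset.Ici j, u i • X i⟫|
      ≤ b * ∑ i ∈ Abarᶜ, ‖θ i‖)
    (hab : a + 2 * b < lam) :
    ∑ i ∈ Abarᶜ, ‖θ i‖ ≤ 2 * ∑ i ∈ Abar, ‖θ i - θ0 i‖ := by
  have key := hmin θ0
  have hres0 : ∀ t, y t - ⟪X t, ∑ k ∈ Finset.Iic t, θ0 k⟫ = u t := fun t => by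
    rw [hy]; ring
  have hres : ∀ t, (y t - ⟪X t, ∑ k ∈ Finset.Iic t, θ k⟫) ^ 2
      = u t ^ 2 - 2 * (u t * ⟪X t, ∑ k ∈ Finset.Iic t, (θ k - θ0 k)⟫)
        + ⟪X t, ∑ k ∈ Finset.Iic t, (θ k - θ0 k)⟫ ^ 2 := fun t => by
    rw [hy, Finset.sum_sub_distrib, inner_sub_right]; ring
  simp only [hres0, hres, Finset.sum_add_distrib, Finset.sum_sub_distrib (f := fun t => u t ^ 2),
    ← Finset.mul_sum] at key
  have hzero : ∀ i ∈ Abarᶜ, θ0 i = 0 := fun i hi => by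
    simpa [hAbar] using hi
  have hcross : (1 / (T : ℝ)) * ∑ t, u t * ⟪X t, ∑ k ∈ Finset.Iic t, (θ k - θ0 k)⟫
      = ∑ j ∈ Abar, ⟪θ j - θ0 j, (1 / (T : ℝ)) • ∑ i ∈ Finset.Ici j, u i • X i⟫
        + ∑ j ∈ Abarᶜ, ⟪θ j, (1 / (T : ℝ)) • ∑ i ∈ Finset.Ici j, u i • X i⟫ := by
    have hcompl : ∑ j ∈ Abarᶜ, ⟪θ j, (1 / (T : ℝ)) • ∑ i ∈ Finset.Ici j, u i • X i⟫
        = ∑ j ∈ Abarᶜ, ⟪θ j - θ0 j, (1 / (T : ℝ)) • ∑ i ∈ Finset.Ici j, u i • X i⟫ :=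
      Finset.sum_congr rfl fun j hj => by rw [hzero j hj, sub_zero]
    rw [hcompl, Finset.sum_add_sum_compl, sum_mul_inner_sum_Iic_s7 X u (fun k => θ k - θ0 k),
      Finset.mul_sum]
    simp only [real_inner_smul_right]
  have hfit : 0 ≤ (1 / (T : ℝ)) * ∑ t, ⟪X t, ∑ k ∈ Finset.Iic t, (θ k - θ0 k)⟫ ^ 2 := by
    positivity
  have hpenalty : ∑ i, ‖θ0 i‖ + ∑ i ∈ Abarᶜ, ‖θ i‖
      ≤ ∑ i, ‖θ i‖ + ∑ i ∈ Abar, ‖θ i - θ0 i‖ := by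
    rw [← Finset.sum_add_sum_compl Abar (fun i => ‖θ i‖),
      ← Finset.sum_add_sum_compl Abar (fun i => ‖θ0 i‖),
      Finset.sum_eq_zero (s := Abarᶜ) (f := fun i => ‖θ0 i‖)
        fun i hi => by rw [hzero i hi, norm_zero]]
    have htri : ∑ i ∈ Abar, ‖θ0 i‖ ≤ ∑ i ∈ Abar, ‖θ i‖ + ∑ i ∈ Abar, ‖θ i - θ0 i‖ := by
      rw [← Finset.sum_add_distrib]
      exact Finset.sum_le_sum fun i _ => norm_le_norm_add_norm_sub (θ i) (θ0 i)
    linarith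
  have hpen := mul_le_mul_of_nonneg_left hpenalty hlam.le
  have hκ₁ : 0 ≤ ∑ i ∈ Abar, ‖θ i - θ0 i‖ := by positivity
  have habs₁ := le_abs_self
    (∑ j ∈ Abar, ⟪θ j - θ0 j, (1 / (T : ℝ)) • ∑ i ∈ Finset.Ici j, u i • X i⟫)
  have habs₂ := le_abs_self
    (∑ j ∈ Abarᶜ, ⟪θ j, (1 / (T : ℝ)) • ∑ i ∈ Finset.Ici j, u i • X i⟫)
  have hcone : (lam - b) * ∑ i ∈ Abarᶜ, ‖θ i‖
      ≤ (lam + a) * ∑ i ∈ Abar, ‖θ i - θ0 i‖ := by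
    linarith
  have hslack := mul_nonneg (sub_nonneg.2 hab.le) hκ₁
  refine le_of_mul_le_mul_left (a := lam - b) ?_ (by linarith)
  linarith
end

section
/- Assume y = Zθ⁰ + u for some θ⁰ ∈ (ℝ^N)^T and u ∈ ℝ^T, let Ā = {i : θ⁰_i ≠ 0} have exactly m₀ + 1 elements with ‖θ⁰_i‖ ≤ M_β for every i ∈ Ā. Let c₀ > 0 and δ ∈ ℝ, set λ = 2Nc₀T^δ, and suppose |(1/T) Σ_{i=j}^T X_{l,i} u_i| ≤ c₀T^δ for every j ∈ {1,…,T} and every coordinate l ∈ {1,…,N}. Let θ̃ be a global minimizer of Q*, and suppose in addition that Σ_{i∉Ā}‖θ̃_i‖ ≤ 2 Σ_{i∈Ā}‖θ̃_i − θ⁰_i‖, and that there is C > 0 such that (1/T²)‖Zm‖² ≥ C Σ_{j∈Ā}‖m_j‖² for every m ∈ (ℝ^N)^T satisfying Σ_{j∉Ā}‖m_j‖ ≤ 2 Σ_{j∈Ā}‖m_j‖. Then (Σ_{i∈Ā}‖θ̃_i − θ⁰_i‖²)^{1/2} ≤ (2/T^{(1−δ)/2}) · √(Nc₀(m₀+1)M_β/C).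 -/
open Finset RealInnerProductSpace

/-- If every coordinate of `a` is at most `c` in absolute value, then
`⟪a, d⟫ ≤ N c ‖d‖`. -/
lemma inner_le_card_mul_of_abs_apply_le {N : ℕ} {a d : EuclideanSpace ℝ (Fin N)} {c : ℝ}
    (ha : ∀ l, |a l| ≤ c) : ⟪a, d⟫ ≤ N * c * ‖d‖ := by
  have h : ∀ l ∈ (univ : Finset (Fin N)), ⟪a l, d l⟫ ≤ c * ‖d‖ := fun l _ => by
    have hd : |d l| ≤ ‖d‖ := PiLp.norm_apply_le d l
    calc ⟪a l, d l⟫ ≤ |a l| * |d l| := real_inner_le_norm _ _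
      _ ≤ c * ‖d‖ := mul_le_mul (ha l) hd (abs_nonneg _) ((abs_nonneg _).trans (ha l))
  rw [PiLp.inner_apply]
  refine (sum_le_sum h).trans_eq ?_
  rw [sum_const, card_univ, Fintype.card_fin, nsmul_eq_mul]
  ring

/-- Summation by parts: the adjoint of the cumulative design map. -/
lemma sum_mul_inner_sum_Iic_s8 {T : ℕ} {E : Type*} [NormedAddCommGroup E] [InnerProductSpace ℝ E]
    (X d : Fin T → E) (u : Fin T → ℝ) :
    ∑ t, u t * ⟪X t, ∑ k ∈ Iic t, d k⟫ = ∑ k, ⟪∑ t ∈ Ici k, u t • X t, d k⟫ := by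
  simp only [inner_sum, sum_inner, mul_sum, real_inner_smul_left]
  exact sum_comm' fun t k => by simp

/-- The noise term of the group lasso is dominated by the penalty. -/
lemma noise_le_penalty {T N : ℕ} (X d : Fin T → EuclideanSpace ℝ (Fin N)) (u : Fin T → ℝ) {c : ℝ}
    (hnoise : ∀ (j : Fin T) (l : Fin N), |(1 / (T : ℝ)) * ∑ i ∈ Ici j, X i l * u i| ≤ c) :
    (1 / (T : ℝ)) * ∑ t, u t * ⟪X t, ∑ k ∈ Iic t, d k⟫ ≤ N * c * ∑ k, ‖d k‖ := by
  rw [sum_mul_inner_sum_Iic_s8, mul_sum, mul_sum]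
  refine sum_le_sum fun k _ => ?_
  rw [← real_inner_smul_left]
  refine inner_le_card_mul_of_abs_apply_le fun l => ?_
  convert hnoise k l using 2
  simp [mul_comm]

/-- The penalty difference is controlled by the signal on its support. -/
lemma sum_norm_sub_add_sub_le {ι E : Type*} [Fintype ι] [NormedAddCommGroup E]
    (θ θ0 : ι → E) {A : Finset ι} (hA : ∀ i ∉ A, θ0 i = 0) :
    ∑ i, ‖θ i - θ0 i‖ + ∑ i, ‖θ0 i‖ - ∑ i, ‖θ i‖ ≤ 2 * ∑ i ∈ A, ‖θ0 i‖ := by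
  have hsupp : ∑ i ∈ A, ‖θ0 i‖ = ∑ i, ‖θ0 i‖ :=
    sum_subset (subset_univ A) fun i _ hi => by simp [hA i hi]
  have htri : ∑ i, ‖θ i - θ0 i‖ ≤ ∑ i, ‖θ i‖ + ∑ i, ‖θ0 i‖ := by
    rw [← sum_add_distrib]
    exact sum_le_sum fun i _ => norm_sub_le _ _
  linarith

/-- The prediction-error bound obtained by comparing a group lasso minimizer with the truth. -/
lemma prediction_error_le {T N : ℕ} (X θ θ0 : Fin T → EuclideanSpace ℝ (Fin N))
    (u y : Fin T → ℝ) (hy : ∀ t, y t = ⟪X t, ∑ k ∈ Iic t, θ0 k⟫ + u t)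
    {A : Finset (Fin T)} (hA : ∀ i ∉ A, θ0 i = 0) {c : ℝ} (hc : 0 ≤ c)
    (hnoise : ∀ (j : Fin T) (l : Fin N), |(1 / (T : ℝ)) * ∑ i ∈ Ici j, X i l * u i| ≤ c)
    (hmin : (1 / (T : ℝ)) * ∑ t, (y t - ⟪X t, ∑ k ∈ Iic t, θ k⟫) ^ 2
          + 2 * N * c * ∑ i, ‖θ i‖
        ≤ (1 / (T : ℝ)) * ∑ t, (y t - ⟪X t, ∑ k ∈ Iic t, θ0 k⟫) ^ 2
          + 2 * N * c * ∑ i, ‖θ0 i‖) :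
    (1 / (T : ℝ)) * ∑ t, ⟪X t, ∑ k ∈ Iic t, (θ k - θ0 k)⟫ ^ 2
      ≤ 4 * N * c * ∑ i ∈ A, ‖θ0 i‖ := by
  have hexp : ∑ t, (y t - ⟪X t, ∑ k ∈ Iic t, θ k⟫) ^ 2
      = ∑ t, (y t - ⟪X t, ∑ k ∈ Iic t, θ0 k⟫) ^ 2
        - 2 * ∑ t, u t * ⟪X t, ∑ k ∈ Iic t, (θ k - θ0 k)⟫
        + ∑ t, ⟪X t, ∑ k ∈ Iic t, (θ k - θ0 k)⟫ ^ 2 := by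
    rw [mul_sum, ← sum_sub_distrib, ← sum_add_distrib]
    refine sum_congr rfl fun t _ => ?_
    rw [hy t, sum_sub_distrib, inner_sub_right]
    ring
  have hn := noise_le_penalty X (fun k => θ k - θ0 k) u hnoise
  have hp := mul_le_mul_of_nonneg_left (sum_norm_sub_add_sub_le θ θ0 hA)
    (show (0 : ℝ) ≤ 2 * N * c by positivity)
  rw [hexp] at hmin
  linarith

/-- Deterministic core of Theorem 1: the ℓ₂ estimation-error bound for the
group lasso under the restricted-eigenvalue-type Assumption 2(iii). -/
theorem stmt8
    (T N : ℕ) (hT : 0 < T)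
    (X : Fin T → EuclideanSpace ℝ (Fin N)) (u : Fin T → ℝ)
    (θ0 : Fin T → EuclideanSpace ℝ (Fin N)) (y : Fin T → ℝ)
    (hy : ∀ t, y t = ⟪X t, ∑ k ∈ Finset.Iic t, θ0 k⟫ + u t)
    (Abar : Finset (Fin T)) (hAbar : ∀ i, i ∈ Abar ↔ θ0 i ≠ 0)
    (m0 : ℕ) (hcard : Abar.card = m0 + 1)
    (Mβ : ℝ) (hMβ : ∀ i ∈ Abar, ‖θ0 i‖ ≤ Mβ)
    (c0 δ : ℝ) (hc0 : 0 < c0)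
    (lam : ℝ) (hlamdef : lam = 2 * (N : ℝ) * c0 * (T : ℝ) ^ δ)
    (hnoise : ∀ (j : Fin T) (l : Fin N),
      |(1 / (T : ℝ)) * ∑ i ∈ Finset.Ici j, X i l * u i| ≤ c0 * (T : ℝ) ^ δ)
    (θ : Fin T → EuclideanSpace ℝ (Fin N))
    (hmin : ∀ η : Fin T → EuclideanSpace ℝ (Fin N),
      (1 / (T : ℝ)) * ∑ t, (y t - ⟪X t, ∑ k ∈ Finset.Iic t, θ k⟫) ^ 2
          + lam * ∑ i, ‖θ i‖
        ≤ (1 / (T : ℝ)) * ∑ t, (y t - ⟪X t, ∑ k ∈ Finset.Iic t, η k⟫) ^ 2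
          + lam * ∑ i, ‖η i‖)
    (hcone : ∑ i ∈ Abarᶜ, ‖θ i‖ ≤ 2 * ∑ i ∈ Abar, ‖θ i - θ0 i‖)
    (C : ℝ) (hC : 0 < C)
    (hRE : ∀ m : Fin T → EuclideanSpace ℝ (Fin N),
      ∑ j ∈ Abarᶜ, ‖m j‖ ≤ 2 * ∑ j ∈ Abar, ‖m j‖ →
      C * ∑ j ∈ Abar, ‖m j‖ ^ 2
        ≤ (1 / (T : ℝ) ^ 2) * ∑ t, (⟪X t, ∑ k ∈ Finset.Iic t, m k⟫) ^ 2) :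
    Real.sqrt (∑ i ∈ Abar, ‖θ i - θ0 i‖ ^ 2)
      ≤ (2 / (T : ℝ) ^ ((1 - δ) / 2))
        * Real.sqrt ((N : ℝ) * c0 * ((m0 : ℝ) + 1) * Mβ / C) := by
  have hTpos : (0 : ℝ) < T := Nat.cast_pos.mpr hT
  have hA : ∀ i ∉ Abar, θ0 i = 0 := fun i hi => by simpa using mt (hAbar i).mpr hi
  have hcone' : ∑ j ∈ Abarᶜ, ‖θ j - θ0 j‖ ≤ 2 * ∑ j ∈ Abar, ‖θ j - θ0 j‖ := by
    rwa [sum_congr rfl fun j hj => by rw [hA j (mem_compl.mp hj), sub_zero]]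
  have hmin0 := hmin θ0
  rw [show lam = 2 * N * (c0 * (T : ℝ) ^ δ) by rw [hlamdef]; ring] at hmin0
  have hpred := prediction_error_le X θ θ0 u y hy hA (by positivity) hnoise hmin0
  have hsignal : ∑ i ∈ Abar, ‖θ0 i‖ ≤ (m0 + 1) * Mβ := by
    simpa [hcard] using sum_le_card_nsmul Abar _ Mβ hMβ
  have hRE' := hRE (fun k => θ k - θ0 k) hcone'
  have hpow : ((T : ℝ) ^ ((1 - δ) / 2)) ^ 2 = T / (T : ℝ) ^ δ := by
    rw [← Real.rpow_natCast, ← Real.rpow_mul hTpos.le, Nat.cast_ofNat,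
      div_mul_cancel₀ _ two_ne_zero, Real.rpow_sub hTpos, Real.rpow_one]
  rw [← Real.sqrt_sq (show 0 ≤ 2 / (T : ℝ) ^ ((1 - δ) / 2) by positivity),
    ← Real.sqrt_mul (sq_nonneg _)]
  refine Real.sqrt_le_sqrt ?_
  rw [div_pow, hpow]
  have hbound : C * ∑ j ∈ Abar, ‖θ j - θ0 j‖ ^ 2
      ≤ 1 / T * (4 * N * (c0 * (T : ℝ) ^ δ) * ((m0 + 1) * Mβ)) := by
    calc C * ∑ j ∈ Abar, ‖θ j - θ0 j‖ ^ 2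
        ≤ 1 / T * (1 / T * ∑ t, ⟪X t, ∑ k ∈ Iic t, (θ k - θ0 k)⟫ ^ 2) :=
          hRE'.trans_eq (by ring)
      _ ≤ 1 / T * (4 * N * (c0 * (T : ℝ) ^ δ) * ((m0 + 1) * Mβ)) := by
          refine mul_le_mul_of_nonneg_left (hpred.trans ?_) (by positivity)
          gcongr
  calc ∑ j ∈ Abar, ‖θ j - θ0 j‖ ^ 2
      ≤ 1 / T * (4 * N * (c0 * (T : ℝ) ^ δ) * ((m0 + 1) * Mβ)) / C :=
        (le_div_iff₀' hC).mpr hbound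
    _ = 2 ^ 2 / (T / (T : ℝ) ^ δ) * (N * c0 * (m0 + 1) * Mβ / C) := by
        field_simp
        ring
end

section
/- Let E be a finite-dimensional real normed vector space, f : E → ℝ a continuous convex function, θ⁰ ∈ E, and r > 0. If f(θ) > f(θ⁰) for every θ with ‖θ − θ⁰‖ = r, then f attains a global minimum over E at some point θ̂ with ‖θ̂ − θ⁰‖ < r. -/
/-- Localization argument in the proof of Theorem 4(a): a continuous convex
function whose values on the sphere of radius `r` around `θ⁰` strictly exceed
its value at `θ⁰` attains a global minimum inside the open ball. -/
theorem stmt11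
    {E : Type*} [NormedAddCommGroup E] [NormedSpace ℝ E] [FiniteDimensional ℝ E]
    (f : E → ℝ) (hf : Continuous f) (hconv : ConvexOn ℝ Set.univ f)
    (θ0 : E) (r : ℝ) (hr : 0 < r)
    (hsphere : ∀ θ, ‖θ - θ0‖ = r → f θ0 < f θ) :
    ∃ θhat, ‖θhat - θ0‖ < r ∧ ∀ θ, f θhat ≤ f θ := by
  obtain ⟨θhat, hmem, hmin⟩ := (isCompact_closedBall θ0 r).exists_isMinOn
    ⟨θ0, Metric.mem_closedBall_self hr.le⟩ hf.continuousOn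
  have hlt : ‖θhat - θ0‖ < r :=
    lt_of_le_of_ne (mem_closedBall_iff_norm.mp hmem) fun heq =>
      (hsphere θhat heq).not_ge (hmin (Metric.mem_closedBall_self hr.le))
  have hlocal : IsLocalMin f θhat :=
    hmin.isLocalMin (Filter.mem_of_superset
      (Metric.isOpen_ball.mem_nhds (mem_ball_iff_norm.mpr hlt)) Metric.ball_subset_closedBall)
  exact ⟨θhat, hlt, IsMinOn.of_isLocalMin_of_convex_univ hlocal hconv⟩
end

section
/- Assume y = Zθ⁰ + u for some θ⁰ ∈ (ℝ^N)^M and u ∈ ℝ^T, and let A = {i : θ⁰_i ≠ 0}. Suppose c* > 0 satisfies ‖Zv‖² ≥ c* T² ‖v‖² for every v ∈ (ℝ^N)^M, and set W = (Σ_{i∈A} w_i²)^{1/2} and B = (Z_1'u, …, Z_M'u) ∈ (ℝ^N)^M. Then for every C > ((2/T)‖B‖ + λW)/c* and every v ∈ (ℝ^N)^M with ‖v‖ = C, one has Q(θ⁰ + T^{-1}v) > Q(θ⁰). -/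
open Finset RealInnerProductSpace

/-- Cauchy–Schwarz for finite families of vectors. -/
theorem sum_inner_le_sqrt_mul_sqrt {ι E : Type*} [NormedAddCommGroup E] [InnerProductSpace ℝ E]
    (s : Finset ι) (a b : ι → E) :
    ∑ i ∈ s, ⟪a i, b i⟫ ≤ √(∑ i ∈ s, ‖a i‖ ^ 2) * √(∑ i ∈ s, ‖b i‖ ^ 2) :=
  (sum_le_sum fun i _ => real_inner_le_norm (a i) (b i)).trans
    (Real.sum_mul_le_sqrt_mul_sqrt s (fun i => ‖a i‖) fun i => ‖b i‖)

/-- Perturbing `θ` by `x` lowers the weighted group penalty by at most the norm of the weights on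
the support of `θ` times the norm of `x`. -/
theorem sum_mul_norm_le_add_sqrt_mul_sqrt {ι E : Type*} [Fintype ι] [NormedAddCommGroup E]
    {w : ι → ℝ} (hw : ∀ i, 0 ≤ w i) {A : Finset ι} {θ : ι → E} (hA : ∀ i, θ i ≠ 0 → i ∈ A)
    (x : ι → E) :
    ∑ i, w i * ‖θ i‖ ≤
      ∑ i, w i * ‖θ i + x i‖ + √(∑ i ∈ A, w i ^ 2) * √(∑ i, ‖x i‖ ^ 2) := by
  have hsupp : ∑ i, w i * ‖θ i‖ = ∑ i ∈ A, w i * ‖θ i‖ := by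
    refine (sum_subset (subset_univ A) fun i _ hi => ?_).symm
    rw [not_not.mp (mt (hA i) hi), norm_zero, mul_zero]
  calc ∑ i, w i * ‖θ i‖ = ∑ i ∈ A, w i * ‖θ i‖ := hsupp
    _ ≤ ∑ i ∈ A, (w i * ‖θ i + x i‖ + w i * ‖x i‖) := by
        refine sum_le_sum fun i _ => ?_
        rw [← mul_add]
        refine mul_le_mul_of_nonneg_left ?_ (hw i)
        simpa using norm_sub_le (θ i + x i) (x i)
    _ = ∑ i ∈ A, w i * ‖θ i + x i‖ + ∑ i ∈ A, w i * ‖x i‖ := sum_add_distrib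
    _ ≤ ∑ i, w i * ‖θ i + x i‖ + √(∑ i ∈ A, w i ^ 2) * √(∑ i, ‖x i‖ ^ 2) := by
        refine add_le_add ?_ ((Real.sum_mul_le_sqrt_mul_sqrt A w fun i => ‖x i‖).trans ?_)
        · exact sum_le_sum_of_subset_of_nonneg (subset_univ A) fun i _ _ =>
            mul_nonneg (hw i) (norm_nonneg _)
        · gcongr
          exact subset_univ A

/-- Quantitative boundary-positivity step in the proof of Theorem 4(a): on the
sphere of radius `C` (for `C` large enough), the adaptive group lasso objective
at `θ⁰ + T⁻¹v` strictly exceeds its value at `θ⁰`. -/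
theorem stmt13
    (T M N : ℕ) (hT : 0 < T)
    (Z : Fin M → EuclideanSpace ℝ (Fin N) →ₗ[ℝ] EuclideanSpace ℝ (Fin T))
    (w : Fin M → ℝ) (hw : ∀ i, 0 ≤ w i) (lam : ℝ) (hlam : 0 < lam)
    (θ0 : Fin M → EuclideanSpace ℝ (Fin N)) (u y : EuclideanSpace ℝ (Fin T))
    (hy : y = (∑ i, Z i (θ0 i)) + u)
    (A : Finset (Fin M)) (hA : ∀ i, i ∈ A ↔ θ0 i ≠ 0)
    (cstar : ℝ) (hcstar : 0 < cstar)
    (hRE : ∀ v : Fin M → EuclideanSpace ℝ (Fin N),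
      cstar * (T : ℝ) ^ 2 * ∑ i, ‖v i‖ ^ 2 ≤ ‖∑ i, Z i (v i)‖ ^ 2) :
    ∀ C : ℝ,
      ((2 / (T : ℝ)) * Real.sqrt (∑ i, ‖LinearMap.adjoint (Z i) u‖ ^ 2)
          + lam * Real.sqrt (∑ i ∈ A, w i ^ 2)) / cstar < C →
      ∀ v : Fin M → EuclideanSpace ℝ (Fin N),
        Real.sqrt (∑ i, ‖v i‖ ^ 2) = C →
        (1 / (T : ℝ)) * ‖y - ∑ i, Z i (θ0 i)‖ ^ 2 + lam * ∑ i, w i * ‖θ0 i‖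
          < (1 / (T : ℝ)) * ‖y - ∑ i, Z i (θ0 i + ((T : ℝ)⁻¹) • v i)‖ ^ 2
            + lam * ∑ i, w i * ‖θ0 i + ((T : ℝ)⁻¹) • v i‖ := by
  intro C hC v hv
  have hTpos : (0 : ℝ) < T := Nat.cast_pos.mpr hT
  set b := √(∑ i, ‖LinearMap.adjoint (Z i) u‖ ^ 2)
  set W := √(∑ i ∈ A, w i ^ 2)
  set G := ∑ i, Z i (v i) with hG
  have hCpos : 0 < C := lt_of_le_of_lt (by positivity) hC
  rw [div_lt_iff₀ hcstar] at hC
  have hvsq : ∑ i, ‖v i‖ ^ 2 = C ^ 2 := by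
    rw [← hv, Real.sq_sqrt (by positivity)]
  have hcross : ⟪u, G⟫ ≤ b * C := by
    have h := sum_inner_le_sqrt_mul_sqrt univ (fun i => LinearMap.adjoint (Z i) u) v
    simpa only [LinearMap.adjoint_inner_left, ← inner_sum, hv] using h
  have hquad : cstar * (T : ℝ) ^ 2 * C ^ 2 ≤ ‖G‖ ^ 2 := hvsq ▸ hRE v
  have hpen : ∑ i, w i * ‖θ0 i‖ ≤
      ∑ i, w i * ‖θ0 i + (T : ℝ)⁻¹ • v i‖ + W * ((T : ℝ)⁻¹ * C) := by
    have h := sum_mul_norm_le_add_sqrt_mul_sqrt hw (fun i => (hA i).mpr)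
      (fun i => (T : ℝ)⁻¹ • v i)
    have hx : √(∑ i, ‖(T : ℝ)⁻¹ • v i‖ ^ 2) = (T : ℝ)⁻¹ * C := by
      simp only [norm_smul, mul_pow, ← mul_sum, hvsq, Real.norm_eq_abs, sq_abs]
      rw [← mul_pow, Real.sqrt_sq (by positivity)]
    rwa [hx] at h
  have hres0 : y - ∑ i, Z i (θ0 i) = u := by rw [hy, add_sub_cancel_left]
  have hres : y - ∑ i, Z i (θ0 i + (T : ℝ)⁻¹ • v i) = u - (T : ℝ)⁻¹ • G := by
    simp only [map_add, map_smul, sum_add_distrib, ← smul_sum, hy, ← hG]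
    abel
  have hexp : ‖u - (T : ℝ)⁻¹ • G‖ ^ 2 =
      ‖u‖ ^ 2 - 2 * ((T : ℝ)⁻¹ * ⟪u, G⟫) + (T : ℝ)⁻¹ ^ 2 * ‖G‖ ^ 2 := by
    rw [norm_sub_sq_real, real_inner_smul_right, norm_smul, mul_pow, Real.norm_eq_abs, sq_abs]
  rw [hres0, hres, hexp]
  set t := (T : ℝ)⁻¹ with ht
  have htpos : 0 < t := inv_pos.mpr hTpos
  have htT : t * T = 1 := inv_mul_cancel₀ hTpos.ne'
  rw [div_eq_mul_inv, ← ht] at hC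
  rw [one_div, ← ht]
  have h1 := mul_le_mul_of_nonneg_left hcross (by positivity : 0 ≤ 2 * t ^ 2)
  have h2 : t * (cstar * C ^ 2) ≤ t ^ 3 * ‖G‖ ^ 2 := by
    calc t * (cstar * C ^ 2) = t ^ 3 * (cstar * (T : ℝ) ^ 2 * C ^ 2) := by
          linear_combination (-(t * cstar * C ^ 2) * (t * T + 1)) * htT
      _ ≤ t ^ 3 * ‖G‖ ^ 2 := mul_le_mul_of_nonneg_left hquad (by positivity)
  have h3 := mul_le_mul_of_nonneg_left hpen hlam.le
  have h4 := mul_lt_mul_of_pos_left hC (mul_pos htpos hCpos)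
  linarith
end

section
/- Assume y = Zθ⁰ + u for some θ⁰ ∈ (ℝ^N)^M and u ∈ ℝ^T, and let θ̂ be a global minimizer of the adaptive group lasso objective Q. If a block index i satisfies (1/T)‖Z_i'u‖ + (1/T)‖Z_i'(Z(θ̂ − θ⁰))‖ < (λ/2)w_i, then θ̂_i = 0. -/
open Finset

open Filter Topology in
/-- Shrinking one block of a group lasso minimizer towards zero cannot decrease the objective, which
bounds the penalty of that block by its correlation with the residual. -/
theorem penalty_le_inner_residual_of_isMin {ι E F : Type*} [Fintype ι]
    [NormedAddCommGroup E] [NormedSpace ℝ E] [NormedAddCommGroup F] [InnerProductSpace ℝ F]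
    (Z : ι → E →ₗ[ℝ] F) (w : ι → ℝ) (c lam : ℝ) (y : F) (θ : ι → E)
    (hmin : ∀ η : ι → E,
      c * ‖y - ∑ i, Z i (θ i)‖ ^ 2 + lam * ∑ i, w i * ‖θ i‖
        ≤ c * ‖y - ∑ i, Z i (η i)‖ ^ 2 + lam * ∑ i, w i * ‖η i‖) (i : ι) :
    lam * (w i * ‖θ i‖) ≤ 2 * c * inner ℝ (y - ∑ j, Z j (θ j)) (Z i (θ i)) := by
  classical
  set r := y - ∑ j, Z j (θ j) with hr
  have shrink : ∀ t ∈ Set.Ioc (0 : ℝ) 1, lam * (w i * ‖θ i‖) ≤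
      2 * c * inner ℝ r (Z i (θ i)) + t * (c * ‖Z i (θ i)‖ ^ 2) := by
    rintro t ⟨ht0, ht1⟩
    have h := hmin (Function.update θ i ((1 - t) • θ i))
    have hfit : y - ∑ j, Z j (Function.update θ i ((1 - t) • θ i) j) = r + t • Z i (θ i) := by
      rw [hr, ← add_sum_erase _ _ (mem_univ i),
        ← add_sum_erase _ (fun j => Z j (θ j)) (mem_univ i),
        sum_congr rfl fun j hj => by rw [Function.update_of_ne (ne_of_mem_erase hj)],
        Function.update_self, map_smul]
      module
    have hpen : ∑ j, w j * ‖Function.update θ i ((1 - t) • θ i) j‖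
        = ∑ j, w j * ‖θ j‖ - t * (w i * ‖θ i‖) := by
      rw [← add_sum_erase _ _ (mem_univ i),
        ← add_sum_erase _ (fun j => w j * ‖θ j‖) (mem_univ i),
        sum_congr rfl fun j hj => by rw [Function.update_of_ne (ne_of_mem_erase hj)],
        Function.update_self, norm_smul, Real.norm_of_nonneg (by linarith)]
      ring
    rw [hfit, hpen, norm_add_sq_real, inner_smul_right, norm_smul, Real.norm_of_nonneg ht0.le] at h
    refine le_of_mul_le_mul_left ?_ ht0
    linarith
  have hlim : Tendsto (fun t : ℝ => 2 * c * inner ℝ r (Z i (θ i)) + t * (c * ‖Z i (θ i)‖ ^ 2))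
      (𝓝[>] 0) (𝓝 (2 * c * inner ℝ r (Z i (θ i)))) :=
    tendsto_nhdsWithin_of_tendsto_nhds (Continuous.tendsto' (by fun_prop) _ _ (by simp))
  exact ge_of_tendsto hlim (eventually_of_mem (Ioc_mem_nhdsGT one_pos) shrink)

/-- Deterministic core of the model-selection part (b) of Theorem 4: a block
whose empirical correlations are small relative to its penalty weight is set
exactly to zero by the adaptive group lasso. -/
theorem stmt14
    (T M N : ℕ) (hT : 0 < T)
    (Z : Fin M → EuclideanSpace ℝ (Fin N) →ₗ[ℝ] EuclideanSpace ℝ (Fin T))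
    (w : Fin M → ℝ) (hw : ∀ i, 0 ≤ w i) (lam : ℝ) (hlam : 0 < lam)
    (θ0 : Fin M → EuclideanSpace ℝ (Fin N)) (u y : EuclideanSpace ℝ (Fin T))
    (hy : y = (∑ i, Z i (θ0 i)) + u)
    (θhat : Fin M → EuclideanSpace ℝ (Fin N))
    (hmin : ∀ η : Fin M → EuclideanSpace ℝ (Fin N),
      (1 / (T : ℝ)) * ‖y - ∑ i, Z i (θhat i)‖ ^ 2 + lam * ∑ i, w i * ‖θhat i‖
        ≤ (1 / (T : ℝ)) * ‖y - ∑ i, Z i (η i)‖ ^ 2 + lam * ∑ i, w i * ‖η i‖) :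
    ∀ i : Fin M,
      (1 / (T : ℝ)) * ‖LinearMap.adjoint (Z i) u‖
          + (1 / (T : ℝ)) * ‖LinearMap.adjoint (Z i) (∑ j, Z j (θhat j - θ0 j))‖
        < (lam / 2) * w i →
      θhat i = 0 := by
  intro i hi
  by_contra hne
  have hpos : 0 < ‖θhat i‖ := norm_pos_iff.mpr hne
  have hfoc := penalty_le_inner_residual_of_isMin Z w _ lam y θhat hmin i
  have hres : y - ∑ j, Z j (θhat j) = u - ∑ j, Z j (θhat j - θ0 j) := by
    simp only [hy, map_sub, sum_sub_distrib]
    abel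
  rw [hres, ← LinearMap.adjoint_inner_left, map_sub] at hfoc
  have hcs := (real_inner_le_norm (LinearMap.adjoint (Z i) u
    - LinearMap.adjoint (Z i) (∑ j, Z j (θhat j - θ0 j))) (θhat i)).trans
      (mul_le_mul_of_nonneg_right (norm_sub_le _ _) hpos.le)
  have hT' : 0 ≤ 1 / (T : ℝ) := by positivity
  have hbound := mul_le_mul_of_nonneg_left hcs hT'
  have hstrict := mul_lt_mul_of_pos_right hi hpos
  linarith
end

section
/- Let I be a finite index set, X_s ∈ ℝ^N and u_s ∈ ℝ for s ∈ I, and set G = Σ_{s∈I} X_s X_s' (an N×N symmetric positive semidefinite matrix). Let β, β', β̃ ∈ ℝ^N and define y_s = ⟨β, X_s⟩ + u_s for s ∈ I. Suppose, for some T, λ > 0: (i) ‖Σ_{s∈I} (y_s − ⟨β̃, X_s⟩) X_s‖ ≤ Tλ/2; (ii) ‖Σ_{s∈I} u_s X_s‖ ≤ (1/3)‖G(β − β')‖; and (iii) ‖G(β' − β̃)‖ ≤ (1/3)‖G(β − β')‖. Then ‖G(β − β')‖ ≤ (3/2)Tλ. Moreover, if in addition there are ρ > 0 and ν > 0 with ⟨v,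 Gv⟩ ≥ ρ‖v‖² for all v ∈ ℝ^N and ‖β − β'‖ ≥ ν, then ρν ≤ (3/2)Tλ. -/
open Finset RealInnerProductSpace

/-- Deterministic core of the proof of Theorem 2: on a stretch `I` between an
estimated and a true breakpoint, the group lasso KKT inequality combined with
the noise bound and the coefficient-estimation bound forces the signal
`‖G(β − β')‖` to be small, which is incompatible with a lower eigenvalue bound
on `G` and a minimum break magnitude `ν`. -/
theorem stmt17
    {ι : Type*} (N : ℕ) (I : Finset ι)
    (X : ι → EuclideanSpace ℝ (Fin N)) (u : ι → ℝ)
    (β β' βt : EuclideanSpace ℝ (Fin N))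
    (T lam : ℝ) (hT : 0 < T) (hlam : 0 < lam)
    (G : EuclideanSpace ℝ (Fin N) → EuclideanSpace ℝ (Fin N))
    (hGdef : ∀ v, G v = ∑ s ∈ I, ⟪X s, v⟫ • X s)
    (y : ι → ℝ) (hy : ∀ s, y s = ⟪β, X s⟫ + u s)
    (h1 : ‖∑ s ∈ I, (y s - ⟪βt, X s⟫) • X s‖ ≤ T * lam / 2)
    (h2 : ‖∑ s ∈ I, u s • X s‖ ≤ (1 / 3) * ‖G (β - β')‖)
    (h3 : ‖G (β' - βt)‖ ≤ (1 / 3) * ‖G (β - β')‖) :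
    ‖G (β - β')‖ ≤ (3 / 2) * T * lam
    ∧ ∀ ρ ν : ℝ, 0 < ρ → 0 < ν →
        (∀ v, ρ * ‖v‖ ^ 2 ≤ ⟪v, G v⟫) → ν ≤ ‖β - β'‖ →
        ρ * ν ≤ (3 / 2) * T * lam := by
  have hdecomp : G (β - β') =
      ∑ s ∈ I, (y s - ⟪βt, X s⟫) • X s - ∑ s ∈ I, u s • X s - G (β' - βt) := by
    rw [hGdef, hGdef, ← Finset.sum_sub_distrib, ← Finset.sum_sub_distrib]
    refine Finset.sum_congr rfl fun s _ => ?_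
    rw [hy, ← sub_smul, ← sub_smul, inner_sub_right, inner_sub_right,
      real_inner_comm β (X s), real_inner_comm βt (X s)]
    congr 1
    ring
  have hbound : ‖G (β - β')‖ ≤ (3 / 2) * T * lam := by
    have htri : ‖G (β - β')‖ ≤ ‖∑ s ∈ I, (y s - ⟪βt, X s⟫) • X s‖
        + ‖∑ s ∈ I, u s • X s‖ + ‖G (β' - βt)‖ := by
      conv_lhs => rw [hdecomp]
      exact (norm_sub_le _ _).trans (add_le_add_left (norm_sub_le _ _) _)
    linarith
  refine ⟨hbound, fun ρ ν hρ hν hG hνle => ?_⟩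
  have hpos : 0 < ‖β - β'‖ := hν.trans_le hνle
  have hlower : ρ * ‖β - β'‖ ≤ ‖G (β - β')‖ := by
    have hcs := (hG (β - β')).trans (real_inner_le_norm _ _)
    refine le_of_mul_le_mul_left ?_ hpos
    linarith
  exact (mul_le_mul_of_nonneg_left hνle hρ.le).trans (hlower.trans hbound)
end
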